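/- Let k ≥ 1 be a natural number and let Z_k(x, ħ) = Σ_{m=0}^∞ (m!)^k · exp(½·m·(m−1)·ħ) · (ħ^k · x)^m for x ∈ ℂ and ħ ∈ ℂ with Re(ħ) < 0. Then Z_k satisfies the Schrödinger-type equation: for every x ∈ ℂ and every ħ with Re(ħ) < 0, the partial derivatives below exist and ∂Z_k/∂ħ (x, ħ) − ½ · x · ∂/∂x ( x · ∂Z_k/∂x (x, ħ) ) + (½ − k/ħ) · x · ∂Z_k/∂x (x, ħ) = 0. -/

import Mathlib

/-- The partition function `Z_k(x, hbar) = Σ_m (m!)^k · exp(½ m (m-1) hbar) · (hbar^k x)^m`,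
as a function of `x` and `hbar`. -/
noncomputable def Zpart (k : ℕ) (x hbar : ℂ) : ℂ :=
  ∑' m : ℕ,
    (m.factorial : ℂ) ^ k * Complex.exp ((m : ℂ) * ((m : ℂ) - 1) / 2 * hbar) *
      (hbar ^ k * x) ^ m

open Filter Topology

/-- If `∑ a m R ^ m` converges absolutely for all `R ≥ 0`, so does `∑ m a m R ^ m`. -/
lemma summable_natCast_mul_of_summable_all {a : ℕ → ℂ}
    (ha : ∀ R : ℝ, 0 ≤ R → Summable fun m => ‖a m‖ * R ^ m) (R : ℝ) (hR : 0 ≤ R) :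
    Summable fun m : ℕ => ‖(m : ℂ) * a m‖ * R ^ m := by
  refine Summable.of_nonneg_of_le (fun m => by positivity) (fun m => ?_)
    (ha (2 * R) (by positivity))
  have hm : (m : ℝ) ≤ 2 ^ m := by exact_mod_cast (Nat.lt_two_pow_self (n := m)).le
  calc ‖(m : ℂ) * a m‖ * R ^ m = m * (‖a m‖ * R ^ m) := by
        rw [norm_mul, Complex.norm_natCast, mul_assoc]
    _ ≤ 2 ^ m * (‖a m‖ * R ^ m) := by gcongr
    _ = ‖a m‖ * (2 * R) ^ m := by rw [mul_pow]; ring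

/-- An everywhere convergent power series is entire, and the Euler operator `y d/dy` acts on it
termwise. -/
lemma differentiableAt_and_hasSum_mul_deriv_powerSeries {a : ℕ → ℂ}
    (ha : ∀ R : ℝ, 0 ≤ R → Summable fun m => ‖a m‖ * R ^ m) (y : ℂ) :
    DifferentiableAt ℂ (fun z => ∑' m, a m * z ^ m) y ∧
      HasSum (fun m : ℕ => (m : ℂ) * a m * y ^ m)
        (y * deriv (fun z => ∑' m, a m * z ^ m) y) := by
  have hu := ha (‖y‖ + 1) (by positivity)
  have hU : IsOpen (Metric.ball (0 : ℂ) (‖y‖ + 1)) := Metric.isOpen_ball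
  have hy : y ∈ Metric.ball (0 : ℂ) (‖y‖ + 1) := by simp
  have hd : ∀ m : ℕ, DifferentiableOn ℂ (fun z : ℂ => a m * z ^ m)
      (Metric.ball (0 : ℂ) (‖y‖ + 1)) := fun m => by fun_prop
  have hle : ∀ (m : ℕ) (w : ℂ), w ∈ Metric.ball (0 : ℂ) (‖y‖ + 1) →
      ‖a m * w ^ m‖ ≤ ‖a m‖ * (‖y‖ + 1) ^ m := fun m w hw => by
    rw [norm_mul, norm_pow]
    gcongr
    exact (mem_ball_zero_iff.mp hw).le
  refine ⟨(Complex.differentiableOn_tsum_of_summable_norm hu hd hU hle).differentiableAt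
    (hU.mem_nhds hy), ?_⟩
  refine ((Complex.hasSum_deriv_of_summable_norm hu hd hU hle hy).mul_left y).congr_fun ?_
  intro m
  rw [deriv_const_mul _ (by fun_prop), deriv_pow_field]
  rcases m with _ | m
  · simp
  · simp only [Nat.add_sub_cancel]; ring

/-- Gaussian decay beats any power of a factorial times any geometric growth. -/
lemma summable_factorial_pow_mul_exp_mul_pow (k : ℕ) {c : ℝ} (hc : 0 < c) {R : ℝ} (hR : 0 ≤ R) :
    Summable fun m : ℕ =>
      (m.factorial : ℝ) ^ k * Real.exp (-(c * ((m : ℝ) * (m - 1) / 2))) * R ^ m := by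
  have hlim : Tendsto (fun m : ℕ => ((m : ℝ) + 1) ^ k * Real.exp (-(c * m)) * R) atTop (𝓝 0) := by
    have h1 : Tendsto (fun t : ℝ => t ^ k * Real.exp (-c * t)) atTop (𝓝 0) := by
      simpa using tendsto_rpow_mul_exp_neg_mul_atTop_nhds_zero k c hc
    have h2 : Tendsto (fun m : ℕ => (m : ℝ) + 1) atTop atTop :=
      tendsto_atTop_add_const_right _ _ tendsto_natCast_atTop_atTop
    have h3 := (h1.comp h2).mul_const (Real.exp c * R)
    rw [zero_mul] at h3
    refine h3.congr fun m => ?_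
    have : Real.exp (-(c * m)) = Real.exp (-c * (m + 1)) * Real.exp c := by
      rw [← Real.exp_add]; ring_nf
    simp only [Function.comp_apply, this]
    ring
  refine summable_of_ratio_norm_eventually_le (r := 1 / 2) (by norm_num) ?_
  filter_upwards [hlim.eventually (ge_mem_nhds (by norm_num : (0 : ℝ) < 1 / 2))] with m hm
  rw [Real.norm_of_nonneg (by positivity), Real.norm_of_nonneg (by positivity)]
  refine le_trans (le_of_eq ?_) (mul_le_mul_of_nonneg_right hm (by positivity))
  have : Real.exp (-(c * (((m + 1 : ℕ) : ℝ) * ((m + 1 : ℕ) - 1) / 2))) =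
      Real.exp (-(c * m)) * Real.exp (-(c * ((m : ℝ) * (m - 1) / 2))) := by
    rw [← Real.exp_add]; push_cast; ring_nf
  rw [this, Nat.factorial_succ]
  push_cast
  rw [mul_pow, pow_succ]
  ring

/-- Bound for the Gaussian factor of the partition function, uniform on `Re h ≤ -c`. -/
lemma norm_exp_gaussian_le {c : ℝ} {h : ℂ} (hc : h.re ≤ -c) (m : ℕ) :
    ‖Complex.exp ((m : ℂ) * ((m : ℂ) - 1) / 2 * h)‖ ≤
      Real.exp (-(c * ((m : ℝ) * (m - 1) / 2))) := by
  have hm : 0 ≤ (m : ℝ) * (m - 1) / 2 := by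
    rcases m with _ | m
    · simp
    · push_cast; rw [add_sub_cancel_right]; positivity
  have hre : ((m : ℂ) * ((m : ℂ) - 1) / 2 * h).re = (m : ℝ) * (m - 1) / 2 * h.re := by
    have : (m : ℂ) * ((m : ℂ) - 1) / 2 = (((m : ℝ) * (m - 1) / 2 : ℝ) : ℂ) := by push_cast; rfl
    rw [this, Complex.re_ofReal_mul]
  rw [Complex.norm_exp, hre, Real.exp_le_exp]
  nlinarith [mul_le_mul_of_nonneg_left hc hm]

/-- The partition function is differentiable in `h`, with termwise derivative. -/
lemma differentiableAt_and_hasSum_deriv_Zpart (k : ℕ) (hbar : ℂ) (hh : hbar.re < 0) (x : ℂ) :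
    DifferentiableAt ℂ (fun h : ℂ => Zpart k x h) hbar ∧
      HasSum (fun m : ℕ => ((m : ℂ) * ((m : ℂ) - 1) / 2 + k * m / hbar) *
        ((m.factorial : ℂ) ^ k * Complex.exp ((m : ℂ) * ((m : ℂ) - 1) / 2 * hbar) *
          (hbar ^ k * x) ^ m))
        (deriv (fun h : ℂ => Zpart k x h) hbar) := by
  have h0 : hbar ≠ 0 := by rintro rfl; simp at hh
  set U : Set ℂ := {h | h.re < hbar.re / 2} ∩ Metric.ball 0 (‖hbar‖ + 1)
  have hU : IsOpen U :=
    (isOpen_lt Complex.continuous_re continuous_const).inter Metric.isOpen_ball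
  have hmem : hbar ∈ U := ⟨by simp only [Set.mem_ofPred_eq]; linarith, by simp⟩
  have hu := summable_factorial_pow_mul_exp_mul_pow k (c := -(hbar.re / 2)) (by linarith)
    (R := (‖hbar‖ + 1) ^ k * ‖x‖) (by positivity)
  have hd : ∀ m : ℕ, DifferentiableOn ℂ (fun h : ℂ =>
      (m.factorial : ℂ) ^ k * Complex.exp ((m : ℂ) * ((m : ℂ) - 1) / 2 * h) *
        (h ^ k * x) ^ m) U := fun m => by fun_prop
  have hle : ∀ (m : ℕ) (h : ℂ), h ∈ U →
      ‖(m.factorial : ℂ) ^ k * Complex.exp ((m : ℂ) * ((m : ℂ) - 1) / 2 * h) * (h ^ k * x) ^ m‖ ≤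
      (m.factorial : ℝ) ^ k * Real.exp (-(-(hbar.re / 2) * ((m : ℝ) * (m - 1) / 2))) *
        ((‖hbar‖ + 1) ^ k * ‖x‖) ^ m := fun m h hm => by
    have hexp := norm_exp_gaussian_le (c := -(hbar.re / 2)) (h := h) (by simpa using hm.1.le) m
    have hball : ‖h‖ ≤ ‖hbar‖ + 1 := (mem_ball_zero_iff.mp hm.2).le
    simp only [norm_mul, norm_pow, Complex.norm_natCast]
    gcongr
  refine ⟨(Complex.differentiableOn_tsum_of_summable_norm hu hd hU hle).differentiableAt
    (hU.mem_nhds hmem), ?_⟩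
  refine (Complex.hasSum_deriv_of_summable_norm hu hd hU hle hmem).congr_fun ?_
  intro m
  have he : HasDerivAt (fun h : ℂ => Complex.exp ((m : ℂ) * ((m : ℂ) - 1) / 2 * h))
      (Complex.exp ((m : ℂ) * ((m : ℂ) - 1) / 2 * hbar) * ((m : ℂ) * ((m : ℂ) - 1) / 2)) hbar := by
    simpa using ((hasDerivAt_id hbar).const_mul ((m : ℂ) * ((m : ℂ) - 1) / 2)).cexp
  have hp : HasDerivAt (fun h : ℂ => (h ^ k * x) ^ m)
      (k * m / hbar * (hbar ^ k * x) ^ m) hbar := by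
    refine (((hasDerivAt_pow k hbar).mul_const x).fun_pow m).congr_deriv ?_
    rcases m with _ | m
    · simp
    rcases k with _ | k
    · simp
    simp only [Nat.add_sub_cancel]
    field_simp
    ring
  rw [((he.const_mul ((m.factorial : ℂ) ^ k)).fun_mul hp).deriv]
  ring

/-- The Schrödinger-type equation: for `k ≥ 1`, `Re hbar < 0` and every `x ∈ ℂ`, the
partial derivatives below exist and
`∂Z/∂hbar − ½ x ∂/∂x (x ∂Z/∂x) + (½ − k/hbar) x ∂Z/∂x = 0`. -/
theorem schroedinger_equation (k : ℕ) (hk : 1 ≤ k) (hbar : ℂ) (hh : hbar.re < 0) (x : ℂ) :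
    DifferentiableAt ℂ (fun h : ℂ => Zpart k x h) hbar ∧
    DifferentiableAt ℂ (fun y : ℂ => Zpart k y hbar) x ∧
    DifferentiableAt ℂ (fun y : ℂ => y * deriv (fun t : ℂ => Zpart k t hbar) y) x ∧
    deriv (fun h : ℂ => Zpart k x h) hbar
      - (1 / 2) * x * deriv (fun y : ℂ => y * deriv (fun t : ℂ => Zpart k t hbar) y) x
      + (1 / 2 - (k : ℂ) / hbar) * x * deriv (fun t : ℂ => Zpart k t hbar) x = 0 := by
  have hZ : ∀ y, Zpart k y hbar = ∑' m : ℕ, (m.factorial : ℂ) ^ k *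
      Complex.exp ((m : ℂ) * ((m : ℂ) - 1) / 2 * hbar) * (hbar ^ k) ^ m * y ^ m := fun y => by
    simp only [Zpart, mul_pow, mul_assoc]
  set a : ℕ → ℂ := fun m => (m.factorial : ℂ) ^ k *
    Complex.exp ((m : ℂ) * ((m : ℂ) - 1) / 2 * hbar) * (hbar ^ k) ^ m with ha
  have hsum : ∀ R : ℝ, 0 ≤ R → Summable fun m => ‖a m‖ * R ^ m := fun R hR => by
    refine Summable.of_nonneg_of_le (fun m => by positivity) (fun m => ?_)
      (summable_factorial_pow_mul_exp_mul_pow k (c := -hbar.re) (by linarith)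
        (R := ‖hbar‖ ^ k * R) (by positivity))
    have hexp := norm_exp_gaussian_le (c := -hbar.re) (h := hbar) (by simp) m
    rw [ha, norm_mul, norm_mul, norm_pow, norm_pow, norm_pow, Complex.norm_natCast,
      mul_pow _ R, ← mul_assoc]
    gcongr
  have hE := differentiableAt_and_hasSum_mul_deriv_powerSeries hsum
  have hE2 := differentiableAt_and_hasSum_mul_deriv_powerSeries
    (summable_natCast_mul_of_summable_all hsum) x
  obtain ⟨hdh, hsh⟩ := differentiableAt_and_hasSum_deriv_Zpart k hbar hh x
  have hfun : (fun y => y * deriv (fun z => ∑' m, a m * z ^ m) y) =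
      fun y => ∑' m : ℕ, (m : ℂ) * a m * y ^ m := funext fun y => (hE y).2.tsum_eq.symm
  have hZfun : (fun t => Zpart k t hbar) = fun z => ∑' m, a m * z ^ m := funext hZ
  rw [hZfun, hfun]
  refine ⟨hdh, (hE x).1, hE2.1, ?_⟩
  have htotal := (hsh.sub (hE2.2.mul_left (1 / 2))).add ((hE x).2.mul_left (1 / 2 - (k : ℂ) / hbar))
  rw [mul_assoc (1 / 2 : ℂ), mul_assoc (1 / 2 - (k : ℂ) / hbar)]
  refine htotal.unique (hasSum_zero.congr_fun fun m => ?_)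
  rw [ha, mul_pow]
  ring
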